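/- Let f be a folding instruction set. Then A_f(n) = 4·φ(n) + n − 1 for all n ≥ 7 if and only if the tail (f_4, f_5, f_6, …) is alternating, i.e., f = (f_0, f_1, f_2, f_3, 1, −1, 1, −1, …) or f = (f_0, f_1, f_2, f_3, −1, 1, −1, 1, …) for some f_0, f_1, f_2, f_3 ∈ {−1, 1}. -/

import Mathlib

/-- A folding instruction set: a sequence with values in {-1, 1}. -/
def FoldingSeq (f : ℕ → ℤ) : Prop := ∀ s, f s = 1 ∨ f s = -1

/-- The paper-folding sequence `P_f`: if `k = 2^s * r` with `r` odd, then
`P_f[k] = f s` if `r ≡ 1 [MOD 4]` and `P_f[k] = -f s` if `r ≡ 3 [MOD 4]`. -/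
def PF (f : ℕ → ℤ) (k : ℕ) : ℤ :=
  if (k / 2 ^ (padicValNat 2 k)) % 4 = 1 then f (padicValNat 2 k)
  else -f (padicValNat 2 k)

/-- The length-`n` factors of `P_f` starting at indices `i` and `j` are identical. -/
def FactorMatch (f : ℕ → ℤ) (n i j : ℕ) : Prop :=
  ∀ t, t < n → PF f (i + t) = PF f (j + t)

/-- `Sf f n` : the least positive integer `m` such that every length-`n` factor of `P_f`
starts somewhere within the first `m` positions. -/
noncomputable def Sf (f : ℕ → ℤ) (n : ℕ) : ℕ :=
  sInf {m | 1 ≤ m ∧ ∀ i, 1 ≤ i → ∃ j, 1 ≤ j ∧ j ≤ m ∧ FactorMatch f n i j}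

/-- `Af f n` : the least positive integer `m` such that every length-`n` factor of `P_f`
appears entirely within the prefix `P_f[1..m]`. -/
noncomputable def Af (f : ℕ → ℤ) (n : ℕ) : ℕ :=
  sInf {m | 1 ≤ m ∧ ∀ i, 1 ≤ i → ∃ j, 1 ≤ j ∧ j + n - 1 ≤ m ∧ FactorMatch f n i j}

/-- `phi2 n` : the least power of 2 that is `≥ n`, i.e. `2 ^ ⌈log₂ n⌉`. -/
def phi2 (n : ℕ) : ℕ := 2 ^ Nat.clog 2 n

theorem PF_two_pow_mul (f : ℕ → ℤ) (s : ℕ) {r : ℕ} (hr : r % 2 = 1) :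
    PF f (2 ^ s * r) = if r % 4 = 1 then f s else -f s := by
  have hv : padicValNat 2 (2 ^ s * r) = s := by
    rw [padicValNat.mul (by positivity) (by omega), padicValNat.prime_pow,
      padicValNat.eq_zero_of_not_dvd (by omega), add_zero]
  rw [PF, hv, Nat.mul_div_cancel_left r (by positivity)]

/-- Below level `k`, the paper-folding sequence is periodic with period `2 ^ (k + 1)`. -/
theorem PF_add_mul_of_not_dvd (f : ℕ → ℤ) {k x : ℕ} (hx : ¬ 2 ^ k ∣ x) (u : ℕ) :
    PF f (x + 2 ^ (k + 1) * u) = PF f x := by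
  have hx0 : x ≠ 0 := by rintro rfl; simp at hx
  obtain ⟨s, r, hr, rfl⟩ := Nat.exists_eq_two_pow_mul_odd hx0
  have hs : s < k := by
    by_contra! h
    exact hx (Dvd.dvd.mul_right (pow_dvd_pow 2 h) r)
  obtain ⟨d, rfl⟩ := Nat.exists_eq_add_of_lt hs
  have hr' : r % 2 = 1 := Nat.odd_iff.mp hr
  have e : 2 ^ s * r + 2 ^ (s + d + 1 + 1) * u = 2 ^ s * (r + 4 * (2 ^ d * u)) := by ring
  rw [e, PF_two_pow_mul f s hr', PF_two_pow_mul f s (by omega), Nat.add_mul_mod_self_left]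

theorem PF_two_pow (f : ℕ → ℤ) (s : ℕ) : PF f (2 ^ s) = f s := by
  simpa using PF_two_pow_mul f s (r := 1) rfl

theorem FoldingSeq.PF_eq_or {f : ℕ → ℤ} (hf : FoldingSeq f) (x : ℕ) :
    PF f x = 1 ∨ PF f x = -1 := by
  have := hf (padicValNat 2 x)
  unfold PF
  split_ifs <;> omega

/-- A factor that starts at a multiple of `2 ^ (k + 1)` and is long enough only recurs at
multiples of `2 ^ (k + 1)`. -/
theorem FactorMatch.two_pow_dvd {f : ℕ → ℤ} (hf : FoldingSeq f) {k n i j : ℕ} (hk : 3 ≤ k)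
    (hn : 7 ≤ n) (hkn : 2 ^ (k - 1) < n) (hi : 2 ^ (k + 1) ∣ i) (h : FactorMatch f n i j) :
    2 ^ (k + 1) ∣ j := by
  have hne : ∀ s, f s ≠ -f s := fun s ↦ by have := hf s; omega
  suffices H : ∀ s ≤ k, 2 ^ (s + 1) ∣ j from H k le_rfl
  intro s
  induction s with
  | zero =>
    intro _
    by_contra hj
    have e : PF f (j + 6) = PF f (j + 2) :=
      PF_add_mul_of_not_dvd f (k := 1) (x := j + 2) (by omega) 1
    obtain ⟨a, ha⟩ : 2 ^ 3 ∣ i := (pow_dvd_pow 2 (by omega)).trans hi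
    have h2 := h 2 (by omega)
    have h6 := h 6 (by omega)
    rw [show i + 2 = 2 ^ 1 * (4 * a + 1) by omega, PF_two_pow_mul f 1 (by omega),
      if_pos (by omega)] at h2
    rw [show i + 6 = 2 ^ 1 * (4 * a + 3) by omega, PF_two_pow_mul f 1 (by omega),
      if_neg (by omega)] at h6
    exact hne 1 (h2.trans (e.symm.trans h6.symm))
  | succ s ih =>
    intro hs
    obtain ⟨c, rfl⟩ := ih (by omega)
    obtain ⟨a, rfl⟩ : 2 ^ (s + 2) ∣ i := (pow_dvd_pow 2 (by omega)).trans hi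
    have ht := h (2 ^ s) ((Nat.pow_le_pow_right two_pos (by omega)).trans_lt hkn)
    rw [show 2 ^ (s + 2) * a + 2 ^ s = 2 ^ s * (4 * a + 1) by ring,
      show 2 ^ (s + 1) * c + 2 ^ s = 2 ^ s * (2 * c + 1) by ring,
      PF_two_pow_mul f s (by omega), PF_two_pow_mul f s (by omega), if_pos (by omega)] at ht
    split_ifs at ht with hc
    · obtain ⟨d, rfl⟩ : 2 ∣ c := by omega
      exact ⟨d, by ring⟩
    · exact absurd ht (hne s)

/-- When `f (k + 1) ≠ f (k + 2)`, every factor of length at most `2 ^ k` starts within the first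
`2 ^ (k + 2)` positions. -/
theorem FoldingSeq.exists_factorMatch_le {f : ℕ → ℤ} (hf : FoldingSeq f) {k n : ℕ}
    (hn : n ≤ 2 ^ k) (hne : f (k + 1) ≠ f (k + 2)) (i : ℕ) :
    ∃ j, 1 ≤ j ∧ j ≤ 2 ^ (k + 2) ∧ FactorMatch f n i j := by
  have hpos : 0 < 2 ^ k := by positivity
  obtain ⟨q, d, hd, hq⟩ : ∃ q d, d < 2 ^ k ∧ i + d = 2 ^ k * q := by
    refine ⟨(i + (2 ^ k - 1)) / 2 ^ k, 2 ^ k - 1 - (i + (2 ^ k - 1)) % 2 ^ k, by omega, ?_⟩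
    have := Nat.div_add_mod (i + (2 ^ k - 1)) (2 ^ k)
    have := Nat.mod_lt (i + (2 ^ k - 1)) hpos
    omega
  have key : ∀ q', 1 ≤ q' → q' ≤ 4 → q % 2 = q' % 2 → PF f (2 ^ k * q) = PF f (2 ^ k * q') →
      ∃ j, 1 ≤ j ∧ j ≤ 2 ^ (k + 2) ∧ FactorMatch f n i j := by
    intro q' h1 h4 hmod hP
    have hle : 2 ^ k * 1 ≤ 2 ^ k * q' := Nat.mul_le_mul_left _ h1
    have hle' : 2 ^ k * q' ≤ 2 ^ k * 4 := Nat.mul_le_mul_left _ h4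
    refine ⟨2 ^ k * q' - d, by omega, by rw [pow_add]; omega, fun t ht ↦ ?_⟩
    obtain ⟨x, hx⟩ : ∃ x, x = 2 ^ k * q' - d + t := ⟨_, rfl⟩
    rw [← hx]
    by_cases htd : t = d
    · rw [htd, hq, hP]; congr 1; omega
    have hnd : ∀ p y, y + d = 2 ^ k * p + t → ¬ 2 ^ k ∣ y := by
      rintro p _ hy ⟨c, rfl⟩
      have hz : ((2 ^ k : ℕ) : ℤ) ∣ (t : ℤ) - d := ⟨(c : ℤ) - p, by push_cast; zify at hy; linarith⟩
      have := Int.eq_zero_of_abs_lt_dvd hz (by rw [abs_lt]; constructor <;> omega)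
      omega
    rcases le_total q q' with hqq | hqq
    · obtain ⟨u, hu⟩ : ∃ u, q' = q + 2 * u := ⟨(q' - q) / 2, by omega⟩
      have e : 2 ^ k * q' = 2 ^ k * q + 2 ^ (k + 1) * u := by rw [hu]; ring
      rw [← PF_add_mul_of_not_dvd f (hnd q (i + t) (by omega)) u]
      congr 1; omega
    · obtain ⟨u, hu⟩ : ∃ u, q = q' + 2 * u := ⟨(q - q') / 2, by omega⟩
      have e : 2 ^ k * q = 2 ^ k * q' + 2 ^ (k + 1) * u := by rw [hu]; ring
      rw [← PF_add_mul_of_not_dvd f (hnd q' x (by omega)) u]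
      congr 1; omega
  rcases Nat.mod_two_eq_zero_or_one q with h | h
  · have h2 : PF f (2 ^ k * 2) = f (k + 1) := PF_two_pow f (k + 1)
    have h4 : PF f (2 ^ k * 4) = f (k + 2) := by
      rw [show 2 ^ k * 4 = 2 ^ (k + 2) by ring, PF_two_pow]
    by_cases hc : PF f (2 ^ k * q) = f (k + 1)
    · exact key 2 (by omega) (by omega) (by omega) (hc.trans h2.symm)
    · refine key 4 (by omega) (by omega) (by omega) ?_
      rw [h4]
      have := hf.PF_eq_or (2 ^ k * q)
      have := hf (k + 1)
      have := hf (k + 2)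
      omega
  · refine key (q % 4) (by omega) (by omega) (by omega) ?_
    rw [PF_two_pow_mul f k h, PF_two_pow_mul f k (by omega), Nat.mod_mod]

/-- Up to `2 ^ (k + 2)`, only the levels `k + 1` and `k + 2` are hit by multiples of
`2 ^ (k + 1)`. -/
theorem eq_two_pow_of_dvd {k j : ℕ} (hj : 1 ≤ j) (hle : j ≤ 2 ^ (k + 2))
    (hd : 2 ^ (k + 1) ∣ j) : j = 2 ^ (k + 1) ∨ j = 2 ^ (k + 2) := by
  obtain ⟨c, rfl⟩ := hd
  rw [pow_succ 2 (k + 1)] at hle ⊢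
  have hc2 : c ≤ 2 := Nat.le_of_mul_le_mul_left hle (by positivity)
  interval_cases c <;> simp_all

theorem FoldingSeq.Af_eq {f : ℕ → ℤ} (hf : FoldingSeq f) {k n : ℕ} (hk : 3 ≤ k) (hn : 7 ≤ n)
    (hlt : 2 ^ (k - 1) < n) (hle : n ≤ 2 ^ k) (hne : f (k + 1) ≠ f (k + 2)) :
    Af f n = 4 * 2 ^ k + n - 1 := by
  have e4 : 4 * 2 ^ k = 2 ^ (k + 2) := by ring
  rw [e4]
  refine IsLeast.csInf_eq ⟨⟨by omega, fun i _ ↦ ?_⟩, ?_⟩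
  · obtain ⟨j, h1, h2, h⟩ := hf.exists_factorMatch_le hle hne i
    exact ⟨j, h1, by omega, h⟩
  · rintro m ⟨-, hm⟩
    obtain ⟨j, h1, h2, h⟩ := hm (2 ^ (k + 2)) Nat.one_le_two_pow
    have hd := h.two_pow_dvd hf hk hn hlt (pow_dvd_pow 2 (by omega))
    by_contra! hlt'
    rcases eq_two_pow_of_dvd h1 (by omega) hd with rfl | rfl
    · have := h 0 (by omega)
      simp only [add_zero, PF_two_pow] at this
      exact hne this.symm
    · omega

theorem FoldingSeq.ne_of_Af_eq {f : ℕ → ℤ} (hf : FoldingSeq f) {k : ℕ} (hk : 3 ≤ k)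
    (hA : Af f (2 ^ k) = 4 * 2 ^ k + 2 ^ k - 1) : f (k + 1) ≠ f (k + 2) := by
  intro heq
  have h8 : 2 ^ 3 ≤ 2 ^ k := Nat.pow_le_pow_right two_pos hk
  have hmem := Nat.sInf_mem (Nat.nonempty_of_pos_sInf (by rw [← Af, hA]; omega) :
    {m | 1 ≤ m ∧ ∀ i, 1 ≤ i → ∃ j, 1 ≤ j ∧ j + 2 ^ k - 1 ≤ m ∧
      FactorMatch f (2 ^ k) i j}.Nonempty)
  rw [← Af, hA] at hmem
  obtain ⟨j, h1, h2, h⟩ := hmem.2 (2 ^ (k + 1) * 3) (Nat.mul_pos (by positivity) (by omega))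
  have e4 : 4 * 2 ^ k = 2 ^ (k + 2) := by ring
  have hd := h.two_pow_dvd hf hk (by omega)
    (Nat.pow_lt_pow_right one_lt_two (by omega)) (dvd_mul_right _ _)
  have h0 := h 0 (by omega)
  rw [add_zero, add_zero, PF_two_pow_mul f (k + 1) (by omega), if_neg (by omega)] at h0
  have := hf (k + 1)
  rcases eq_two_pow_of_dvd h1 (by omega) hd with rfl | rfl <;> rw [PF_two_pow] at h0 <;> omega

theorem FoldingSeq.alternating_iff {f : ℕ → ℤ} (hf : FoldingSeq f) :
    (∀ s, 4 ≤ s → f s ≠ f (s + 1)) ↔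
      ((∀ s, 4 ≤ s → f s = if Even s then 1 else -1) ∨
       (∀ s, 4 ≤ s → f s = if Even s then -1 else 1)) := by
  constructor
  · intro h
    have step : ∀ s, 4 ≤ s → f (s + 1) = -f s := fun s hs ↦ by
      have := h s hs
      have := hf s
      have := hf (s + 1)
      omega
    refine (hf 4).imp (fun h4 s hs ↦ ?_) (fun h4 s hs ↦ ?_) <;>
    · induction s, hs using Nat.le_induction with
      | base => rw [h4, if_pos (by decide)]
      | succ s hs ih =>
        rw [step s hs, ih]
        by_cases he : Even s <;> simp [he, Nat.even_add_one]
  · rintro (h | h) s hs <;> rw [h s hs, h (s + 1) (by omega)] <;>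
      by_cases he : Even s <;> simp [he, Nat.even_add_one]

theorem stmt2 (f : ℕ → ℤ) (hf : FoldingSeq f) :
    (∀ n, 7 ≤ n → Af f n = 4 * phi2 n + n - 1) ↔
      ((∀ s, 4 ≤ s → f s = if Even s then 1 else -1) ∨
       (∀ s, 4 ≤ s → f s = if Even s then -1 else 1)) := by
  rw [← hf.alternating_iff]
  constructor
  · intro h s hs
    obtain ⟨k, rfl⟩ : ∃ k, s = k + 1 := ⟨s - 1, by omega⟩
    have h8 : 2 ^ 3 ≤ 2 ^ k := Nat.pow_le_pow_right two_pos (by omega)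
    refine hf.ne_of_Af_eq (by omega) ?_
    rw [h (2 ^ k) (by omega), phi2, Nat.clog_pow 2 k one_lt_two]
  · intro h n hn
    have hk : 2 < Nat.clog 2 n := (Nat.lt_clog_iff_pow_lt one_lt_two).2 (by omega)
    exact hf.Af_eq hk hn (Nat.pow_pred_clog_lt_self one_lt_two (by omega))
      (Nat.le_pow_clog one_lt_two n) (h _ (by omega))
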